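/- Let n > 2 and q > 0 be integers such that n is even or q is odd, and let p be a prime with p > max{n, (q-1)n + 1}. Then the rational number ∑_{k=0}^{p-q} ((q)_k^n / (1)_k^n) · ((H_k^{(1)})^2 - (H_{q+k-1}^{(1)})^2) is congruent to 0 modulo p, i.e., its p-adic valuation is at least 1. -/

import Mathlib

/-- `H m k` is the `k`-th harmonic number of order `m`: `H_k^{(m)} = ∑_{j=1}^k 1/j^m`. -/
def harm (m k : ℕ) : ℚ := ∑ j ∈ Finset.range k, 1 / ((j : ℚ) + 1) ^ m

/-- `x` is a `p`-integral rational number whose reduction modulo `p` is `z`. -/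
def ReducesTo (p : ℕ) [Fact p.Prime] (x : ℚ) (z : ZMod p) : Prop :=
  ∃ a b : ℤ, ¬ ((p : ℤ) ∣ b) ∧ x = a / b ∧ z = a / b

/-- The `k`-th harmonic number computed in `ZMod p`. -/
def harmZMod (p k : ℕ) [Fact p.Prime] : ZMod p := ∑ j ∈ Finset.range k, 1 / ((j : ZMod p) + 1)

section

variable {p : ℕ} [Fact p.Prime]

namespace ReducesTo

variable {x y : ℚ} {z w : ZMod p}

lemma natCast (a : ℕ) : ReducesTo p (a : ℚ) (a : ZMod p) :=
  ⟨a, 1, (Nat.prime_iff_prime_int.mp Fact.out).not_dvd_one, by simp, by simp⟩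

lemma add (hx : ReducesTo p x z) (hy : ReducesTo p y w) : ReducesTo p (x + y) (z + w) := by
  obtain ⟨a, b, hb, rfl, rfl⟩ := hx
  obtain ⟨c, d, hd, rfl, rfl⟩ := hy
  have hbd := (Nat.prime_iff_prime_int.mp (Fact.out : p.Prime)).not_dvd_mul hb hd
  have hb' : (b : ZMod p) ≠ 0 := by rwa [Ne, ZMod.intCast_zmod_eq_zero_iff_dvd]
  have hd' : (d : ZMod p) ≠ 0 := by rwa [Ne, ZMod.intCast_zmod_eq_zero_iff_dvd]
  have hb0 : (b : ℚ) ≠ 0 := by rintro h; simp_all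
  have hd0 : (d : ℚ) ≠ 0 := by rintro h; simp_all
  refine ⟨a * d + b * c, b * d, hbd, ?_, ?_⟩
  · push_cast; rw [div_add_div _ _ hb0 hd0]
  · push_cast; rw [div_add_div _ _ hb' hd']

lemma mul (hx : ReducesTo p x z) (hy : ReducesTo p y w) : ReducesTo p (x * y) (z * w) := by
  obtain ⟨a, b, hb, rfl, rfl⟩ := hx
  obtain ⟨c, d, hd, rfl, rfl⟩ := hy
  refine ⟨a * c, b * d, (Nat.prime_iff_prime_int.mp Fact.out).not_dvd_mul hb hd, ?_, ?_⟩ <;>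
    push_cast <;> rw [div_mul_div_comm]

lemma neg (hx : ReducesTo p x z) : ReducesTo p (-x) (-z) := by
  obtain ⟨a, b, hb, rfl, rfl⟩ := hx
  exact ⟨-a, b, hb, by push_cast; ring, by push_cast; ring⟩

lemma sub (hx : ReducesTo p x z) (hy : ReducesTo p y w) : ReducesTo p (x - y) (z - w) := by
  simpa only [sub_eq_add_neg] using hx.add hy.neg

lemma pow (hx : ReducesTo p x z) (n : ℕ) : ReducesTo p (x ^ n) (z ^ n) := by
  induction n with
  | zero => simpa using natCast (p := p) 1
  | succ n ih => simpa only [pow_succ] using ih.mul hx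

lemma sum_range {f : ℕ → ℚ} {g : ℕ → ZMod p} (N : ℕ)
    (h : ∀ k < N, ReducesTo p (f k) (g k)) :
    ReducesTo p (∑ k ∈ Finset.range N, f k) (∑ k ∈ Finset.range N, g k) := by
  induction N with
  | zero => simpa using natCast (p := p) 0
  | succ N ih =>
    simp only [Finset.sum_range_succ]
    exact (ih fun k hk => h k (by omega)).add (h N (by omega))

lemma one_div_succ {j : ℕ} (hj : j + 1 < p) :
    ReducesTo p (1 / ((j : ℚ) + 1)) (1 / ((j : ZMod p) + 1)) := by
  refine ⟨1, (j + 1 : ℕ), ?_, by push_cast; ring, by push_cast; ring⟩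
  rw [Int.natCast_dvd_natCast]
  exact Nat.not_dvd_of_pos_of_lt j.succ_pos hj

lemma harm {k : ℕ} (hk : k < p) : ReducesTo p (harm 1 k) (harmZMod p k) := by
  unfold _root_.harm harmZMod
  simp only [pow_one]
  exact sum_range k fun j hj => one_div_succ (by omega)

lemma exists_eq_mul_div (h : ReducesTo p x 0) :
    ∃ a b : ℤ, ¬ ((p : ℤ) ∣ b) ∧ x = (p : ℚ) * a / b := by
  obtain ⟨a, b, hb, rfl, h0⟩ := h
  have hb' : (b : ZMod p) ≠ 0 := by rwa [Ne, ZMod.intCast_zmod_eq_zero_iff_dvd]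
  have ha : (a : ZMod p) = 0 := by simpa [hb'] using h0.symm
  obtain ⟨c, rfl⟩ := (ZMod.intCast_zmod_eq_zero_iff_dvd _ _).mp ha
  exact ⟨c, b, hb, by push_cast; ring⟩

end ReducesTo

lemma natCast_prime_sub_one_sub {j : ℕ} (hj : j + 1 ≤ p) :
    ((p - 1 - j : ℕ) : ZMod p) = -((j : ZMod p) + 1) := by
  rw [Nat.sub_sub, Nat.cast_sub (by omega)]
  simp [add_comm]

lemma ZMod.two_ne_zero_of_two_lt (hp : 2 < p) : (2 : ZMod p) ≠ 0 := by
  intro h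
  have : ((2 : ℕ) : ZMod p) = 0 := by exact_mod_cast h
  rw [ZMod.natCast_eq_zero_iff] at this
  exact absurd (Nat.le_of_dvd two_pos this) (by omega)

lemma harmZMod_prime_sub_one (hp : 2 < p) : harmZMod p (p - 1) = 0 := by
  have h : harmZMod p (p - 1) = -harmZMod p (p - 1) := by
    conv_lhs => rw [harmZMod, ← Finset.sum_range_reflect]
    rw [harmZMod, ← Finset.sum_neg_distrib]
    refine Finset.sum_congr rfl fun j hj => ?_
    rw [Finset.mem_range] at hj
    rw [← Nat.cast_succ, show (p - 1 - 1 - j).succ = p - 1 - j by omega,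
      natCast_prime_sub_one_sub (by omega), one_div_neg_eq_neg_one_div]
  have h2 : 2 * harmZMod p (p - 1) = 0 := by linear_combination h
  exact (mul_eq_zero.mp h2).resolve_left (ZMod.two_ne_zero_of_two_lt hp)

lemma harmZMod_prime_sub_one_sub (hp : 2 < p) {j : ℕ} (hj : j < p) :
    harmZMod p (p - 1 - j) = harmZMod p j := by
  induction j with
  | zero => simpa [harmZMod] using harmZMod_prime_sub_one hp
  | succ j ih =>
    have h := ih (by omega)
    rw [show p - 1 - j = p - 1 - (j + 1) + 1 by omega] at h
    unfold harmZMod at h ⊢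
    rw [Finset.sum_range_succ, ← Nat.cast_succ,
      show (p - 1 - (j + 1)).succ = p - 1 - j by omega,
      natCast_prime_sub_one_sub (by omega), one_div_neg_eq_neg_one_div] at h
    rw [Finset.sum_range_succ]
    linear_combination h

lemma natCast_choose_prime_sub_one_sub {k m : ℕ} (h : k + m < p) :
    ((p - 1 - k).choose m : ZMod p) = (-1) ^ m * ((m + k).choose m : ZMod p) := by
  have hm : (m.factorial : ZMod p) ≠ 0 := by
    rw [Ne, ZMod.natCast_eq_zero_iff, (Fact.out : p.Prime).dvd_factorial]
    omega
  apply mul_left_cancel₀ hm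
  have h1 := Nat.descFactorial_eq_factorial_mul_choose (p - 1 - k) m
  have h2 := Nat.ascFactorial_eq_factorial_mul_choose k m
  rw [mul_left_comm, add_comm m k, ← Nat.cast_mul, ← Nat.cast_mul, ← h1, ← h2,
    Nat.descFactorial_eq_prod_range, Nat.ascFactorial_eq_prod_range, Nat.cast_prod,
    Nat.cast_prod, ← Finset.card_range m, ← Finset.prod_const, Finset.card_range,
    ← Finset.prod_mul_distrib]
  refine Finset.prod_congr rfl fun i hi => ?_
  rw [Finset.mem_range] at hi
  rw [Nat.sub_sub (p - 1), natCast_prime_sub_one_sub (by omega)]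
  push_cast
  ring

lemma sum_choose_pow_mul_harmZMod_eq_zero (hp : 2 < p) {m n : ℕ} (hm : m < p)
    (hpar : Even (m * n)) :
    ∑ k ∈ Finset.range (p - m), ((m + k).choose m : ZMod p) ^ n *
      (harmZMod p k ^ 2 - harmZMod p (m + k) ^ 2) = 0 := by
  set f : ℕ → ZMod p := fun k => ((m + k).choose m : ZMod p) ^ n *
    (harmZMod p k ^ 2 - harmZMod p (m + k) ^ 2)
  have h : ∑ k ∈ Finset.range (p - m), f k = -∑ k ∈ Finset.range (p - m), f k := by
    conv_lhs => rw [← Finset.sum_range_reflect]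
    rw [← Finset.sum_neg_distrib]
    refine Finset.sum_congr rfl fun k hk => ?_
    rw [Finset.mem_range] at hk
    simp only [f]
    rw [show m + (p - m - 1 - k) = p - 1 - k by omega,
      show p - m - 1 - k = p - 1 - (m + k) by omega,
      natCast_choose_prime_sub_one_sub (by omega), harmZMod_prime_sub_one_sub hp (by omega),
      harmZMod_prime_sub_one_sub hp (by omega), mul_pow, ← pow_mul, hpar.neg_one_pow]
    ring
  have h2 : 2 * ∑ k ∈ Finset.range (p - m), f k = 0 := by linear_combination h
  exact (mul_eq_zero.mp h2).resolve_left (ZMod.two_ne_zero_of_two_lt hp)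

end

lemma ascPochhammer_eval_succ_div_eval_one (m k : ℕ) :
    (ascPochhammer ℚ k).eval ((m + 1 : ℕ) : ℚ) / (ascPochhammer ℚ k).eval 1 =
      ((m + k).choose m : ℚ) := by
  rw [← ascPochhammer_eval_cast, ascPochhammer_nat_eq_ascFactorial,
    Nat.ascFactorial_eq_factorial_mul_choose, ascPochhammer_eval_one, Nat.cast_mul,
    mul_div_cancel_left₀ _ (by exact_mod_cast k.factorial_ne_zero), Nat.choose_symm_add]

/-- For integers `n > 2` and `q > 0` with `n` even or `q` odd, and any prime
`p > max {n, (q-1)n+1}`, the rational number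
`∑_{k=0}^{p-q} ((q)_k^n / (1)_k^n) ((H_k^{(1)})^2 - (H_{q+k-1}^{(1)})^2)`
is congruent to `0` modulo `p`, i.e. it can be written as `p * a / b` with `p ∤ b`. -/
theorem stmt_11 (n q : ℕ) (hn : 2 < n) (hq : 0 < q) (hpar : Even n ∨ Odd q)
    (p : ℕ) (hp : p.Prime) (hgt : p > max n ((q - 1) * n + 1)) :
    ∃ a b : ℤ, ¬ ((p : ℤ) ∣ b) ∧
      ∑ k ∈ Finset.range (p - q + 1),
          (((ascPochhammer ℚ k).eval (q : ℚ)) ^ n / ((ascPochhammer ℚ k).eval 1) ^ n) *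
            ((harm 1 k) ^ 2 - (harm 1 (q + k - 1)) ^ 2)
        = (p : ℚ) * a / b := by
  have : Fact p.Prime := ⟨hp⟩
  obtain ⟨m, rfl⟩ : ∃ m, q = m + 1 := ⟨q - 1, by omega⟩
  rw [Nat.add_sub_cancel, gt_iff_lt, max_lt_iff] at hgt
  have hmp : m + 1 < p := by nlinarith
  have hpar' : Even (m * n) := by grind
  apply ReducesTo.exists_eq_mul_div
  rw [← sum_choose_pow_mul_harmZMod_eq_zero (by omega) (by omega) hpar',
    show p - (m + 1) + 1 = p - m by omega]
  refine ReducesTo.sum_range _ fun k hk => ?_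
  rw [← div_pow, ascPochhammer_eval_succ_div_eval_one, show m + 1 + k - 1 = m + k by omega]
  exact ((ReducesTo.natCast _).pow n).mul
    (((ReducesTo.harm (by omega)).pow 2).sub ((ReducesTo.harm (by omega)).pow 2))
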